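/- Let (A,[·,·]) be a finite-dimensional Malcev algebra over a field K of characteristic 0 and suppose the dual space A* carries a Malcev algebra bracket [·,·]*. Define ad*_A : A → End(A*) by (ad*_A(x)ξ)(y) = −ξ([x,y]) and ad*_{A*} : A* → End(A) by ⟨ad*_{A*}(ξ)x, η⟩ = −⟨x, [ξ,η]*⟩ (using the canonical pairing ⟨x,η⟩ = η(x)). Then the following are equivalent: (i) there exists a Malcev algebra bracket on A ⊕ A* whose restrictions to A and to A* are [·,·] and [·,·]* respectively (so A and A* are subalgebras), and for which the bilinear form B_d(x+ξ, y+η) = η(x) + ξ(y) is invariant, i.e. B_d([u,v], w) = B_d(u, [v,w]) for all u,v,w ∈ A ⊕ A*; (ii) (A, A*, ad*_A, ad*_{A*}) is a matched pair of Malcev algebras. -/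

import Mathlib

open scoped TensorProduct

namespace MPA

variable (K : Type*) [Field K] [CharZero K]

section Basic
variable {A B V : Type*}
variable [AddCommGroup A] [Module K A] [AddCommGroup B] [Module K B]
variable [AddCommGroup V] [Module K V]

/-- A two-argument map is bilinear. -/
def IsBilin (m : A → A → B) : Prop :=
  (∀ x : A, IsLinearMap K (m x)) ∧ (∀ y : A, IsLinearMap K fun x => m x y)

/-- Bundle a bilinear two-argument map. -/
def mkBilin (m : A → A → B) (h : IsBilin K m) : A →ₗ[K] A →ₗ[K] B :=
  LinearMap.mk₂ K m (fun x y z => (h.2 z).map_add x y) (fun c x y => (h.2 y).map_smul c x)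
    (fun x y z => (h.1 x).map_add y z) (fun c x y => (h.1 x).map_smul c y)

/-- Bundle the left multiplications of a bilinear map as endomorphisms. -/
def mkEnd (m : A → A → A) (h : IsBilin K m) : A → Module.End K A :=
  fun x => IsLinearMap.mk' (m x) (h.1 x)

/-- The Jacobian `J(x,y,z) = [[x,y],z] + [[z,x],y] + [[y,z],x]`. -/
def Jacobian (br : A → A → A) (x y z : A) : A :=
  br (br x y) z + br (br z x) y + br (br y z) x

/-- Antisymmetry. -/
def IsSkew (br : A → A → A) : Prop := ∀ x y, br x y = - br y x

/-- Sagle's identity. -/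
def SagleIdentity (br : A → A → A) : Prop :=
  ∀ x y z t, br (br x z) (br y t) =
    br (br (br x y) z) t + br (br (br y z) t) x + br (br (br z t) x) y + br (br (br t x) y) z

/-- A Malcev algebra structure: an antisymmetric bilinear bracket satisfying Sagle's identity. -/
def IsMalcev (br : A → A → A) : Prop :=
  IsBilin K br ∧ IsSkew br ∧ SagleIdentity br

/-- A commutative associative algebra structure given by a bilinear product. -/
def IsCommAssoc (m : A → A → A) : Prop :=
  IsBilin K m ∧ (∀ x y, m x y = m y x) ∧ ∀ x y z, m (m x y) z = m x (m y z)

/-- A Malcev-Poisson algebra: a Malcev bracket and a commutative associative product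
satisfying the Leibniz rule. -/
def IsMalcevPoisson (br m : A → A → A) : Prop :=
  IsMalcev K br ∧ IsCommAssoc K m ∧
    ∀ x y z, br x (m y z) = m (br x y) z + m y (br x z)

/-- The defining identity of a representation of a Malcev algebra. -/
def IsMalcevRepMap (br : A → A → A) (ρ : A → Module.End K V) : Prop :=
  ∀ x y z, ρ (br (br x y) z) =
    ρ z * ρ y * ρ x - ρ y * ρ x * ρ z + ρ x * ρ (br y z) + ρ (br x z) * ρ y

/-- A representation of a Malcev algebra. -/
def IsMalcevRep (br : A → A → A) (ρ : A → Module.End K V) : Prop :=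
  IsLinearMap K ρ ∧ IsMalcevRepMap K br ρ

/-- A representation of a (commutative) associative algebra. -/
def IsAssocRep (m : A → A → A) (μ : A → Module.End K V) : Prop :=
  IsLinearMap K μ ∧ ∀ x y, μ (m x y) = μ x * μ y

/-- A representation of a Malcev-Poisson algebra. -/
def IsMPRep (br m : A → A → A) (ρ μ : A → Module.End K V) : Prop :=
  IsMalcevRep K br ρ ∧ IsAssocRep K m μ ∧
  (∀ x y, ρ (m x y) = μ y * ρ x + μ x * ρ y) ∧
  (∀ x y, μ (br x y) = ρ x * μ y - μ y * ρ x)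

/-- An `A`-module Malcev algebra. -/
def IsModuleMalcevAlg (br : A → A → A) (brV : V → V → V) (ρ : A → Module.End K V) : Prop :=
  IsMalcev K brV ∧ IsMalcevRep K br ρ ∧
  (∀ x y a b, ρ (br x y) (brV a b) =
      ρ x (brV (ρ y a) b) - brV (ρ y (ρ x a)) b - brV (ρ x (ρ y b)) a + ρ y (brV (ρ x b) a)) ∧
  (∀ x y a b, brV (ρ x a) (ρ y b) =
      brV (ρ (br x y) a) b - ρ x (brV (ρ y a) b) + ρ y (ρ x (brV a b)) + brV (ρ y (ρ x b)) a) ∧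
  (∀ x a b c, brV (ρ x a) (brV b c) =
      brV (brV (ρ x b) a) c - ρ x (brV (brV b a) c) - brV (ρ x (brV a c)) b - brV (brV (ρ x c) b) a)

/-- An `A`-module associative algebra. -/
def IsModuleAssocAlg (m : A → A → A) (mV : V → V → V) (μ : A → Module.End K V) : Prop :=
  IsCommAssoc K mV ∧ IsAssocRep K m μ ∧ ∀ x a b, μ x (mV a b) = mV (μ x a) b

/-- An `A`-module Malcev-Poisson algebra. -/
def IsModuleMP (br m : A → A → A) (brV mV : V → V → V) (ρ μ : A → Module.End K V) : Prop :=
  IsModuleMalcevAlg K br brV ρ ∧ IsModuleAssocAlg K m mV μ ∧ IsMPRep K br m ρ μ ∧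
  (∀ x a b, ρ x (mV a b) = mV (ρ x a) b + mV a (ρ x b)) ∧
  (∀ x a b, brV a (μ x b) = - mV (ρ x a) b + μ x (brV a b))

/-- The sub-adjacent bracket `{x,y} = x◇y − y◇x + [x,y]` of a post-Malcev algebra. -/
def pmBr (br dia : A → A → A) : A → A → A := fun x y => dia x y - dia y x + br x y

/-- The associated product `x∘y = x▷y + y▷x + x·y` of a commutative dendriform trialgebra. -/
def trialMul (mdot tri : A → A → A) : A → A → A := fun x y => tri x y + tri y x + mdot x y

/-- A post-Malcev algebra. -/
def IsPostMalcev (br dia : A → A → A) : Prop :=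
  IsMalcev K br ∧ IsBilin K dia ∧
  (∀ x y z t, dia (pmBr br dia x z) (br y t) =
      dia x (br (dia z y) t) - br (dia z (dia x y)) t - br (dia x (dia z t)) y
        + dia z (br (dia x t) y)) ∧
  (∀ x y z t, br (dia x z) (dia y t) =
      br (dia (pmBr br dia x y) z) t - dia x (br (dia y z) t) + dia y (dia x (br z t))
        + br (dia y (dia x t)) z) ∧
  (∀ x y z t, br (dia x z) (br y t) =
      br (br (dia x y) z) t - dia x (br (br y z) t) - br (dia x (br z t)) y
        - br (br (dia x t) y) z) ∧
  (∀ x y z t, dia (pmBr br dia y z) (dia x t) =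
      dia (pmBr br dia (pmBr br dia x y) z) t + dia y (dia (pmBr br dia x z) t)
        + dia x (dia y (dia z t)) - dia z (dia x (dia y t)))

/-- A commutative dendriform trialgebra. -/
def IsCommTridend (mdot tri : A → A → A) : Prop :=
  IsCommAssoc K mdot ∧ IsBilin K tri ∧
  (∀ x y z, tri (trialMul mdot tri x y) z = tri x (tri y z)) ∧
  (∀ x y z, mdot (tri x y) z = tri x (mdot y z))

/-- A post-Malcev-Poisson algebra. -/
def IsPostMP (br dia mdot tri : A → A → A) : Prop :=
  IsMalcevPoisson K br mdot ∧ IsPostMalcev K br dia ∧ IsCommTridend K mdot tri ∧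
  (∀ x y z, dia x (mdot y z) = mdot (dia x y) z + mdot y (dia x z)) ∧
  (∀ x y z, br x (tri z y) = tri z (br x y) - mdot y (dia z x)) ∧
  (∀ x y z, dia (trialMul mdot tri y z) x = tri z (dia y x) + tri y (dia z x)) ∧
  (∀ x y z, tri (pmBr br dia x z) y = dia x (tri z y) - tri z (dia x y))

/-- The dual representation `ρ*(x) = −ρ(x)*`. -/
def dualRepNeg (ρ : A → Module.End K V) : A → Module.End K (Module.Dual K V) :=
  fun x => -(ρ x).dualMap

/-- The dual map `x ↦ μ(x)*` (used for `−μ*`). -/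
def dualRepPos (μ : A → Module.End K V) : A → Module.End K (Module.Dual K V) :=
  fun x => (μ x).dualMap

end Basic

section Matched
variable {A1 A2 : Type*} [AddCommGroup A1] [Module K A1] [AddCommGroup A2] [Module K A2]

/-- Identities (M1), (M3), (M5) of a matched pair of Malcev algebras. -/
def MalcevCompatHalf (br1 : A1 → A1 → A1) (br2 : A2 → A2 → A2)
    (ρ1 : A1 → Module.End K A2) (ρ2 : A2 → Module.End K A1) : Prop :=
  (∀ (x1 y1 z1 : A1) (x2 : A2),
      br1 (br1 (ρ2 x2 x1) y1) z1 - br1 (ρ2 x2 (br1 y1 z1)) x1 - br1 (ρ2 (ρ1 x1 x2) y1) z1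
      - br1 (br1 (ρ2 x2 z1) x1) y1 + ρ2 (ρ1 y1 (ρ1 x1 x2)) z1 + br1 (br1 x1 z1) (ρ2 x2 y1)
      - ρ2 x2 (br1 (br1 x1 y1) z1) + ρ2 (ρ1 y1 x2) (br1 x1 z1) + br1 (ρ2 (ρ1 z1 x2) x1) y1
      + ρ2 (ρ1 (br1 y1 z1) x2) x1 - ρ2 (ρ1 x1 (ρ1 z1 x2)) y1 = 0) ∧
  (∀ (x1 y1 : A1) (x2 y2 : A2),
      ρ2 (ρ1 x1 (br2 x2 y2)) y1 - ρ2 (ρ1 x1 x2) (ρ2 y2 y1) + ρ2 x2 (br1 (ρ2 y2 x1) y1)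
      - br1 (ρ2 y2 (ρ2 x2 y1)) x1 - br1 (ρ2 (br2 x2 y2) x1) y1 + ρ2 (ρ1 y1 y2) (ρ2 x2 x1)
      - ρ2 (br2 (ρ1 y1 x2) y2) x1 - ρ2 y2 (ρ2 x2 (br1 x1 y1)) + br1 (ρ2 x2 x1) (ρ2 y2 y1)
      - ρ2 x2 (ρ2 (ρ1 x1 y2) y1) + ρ2 (ρ1 (ρ2 x2 y1) y2) x1 = 0) ∧
  (∀ (x1 y1 : A1) (x2 y2 : A2),
      ρ2 x2 (br1 (ρ2 y2 y1) x1) - ρ2 (br2 (ρ1 x1 y2) x2) y1 - br1 (ρ2 x2 (ρ2 y2 x1)) y1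
      + ρ2 y2 (br1 (ρ2 x2 x1) y1) - br1 (ρ2 y2 (ρ2 x2 y1)) x1 - ρ2 (br2 (ρ1 y1 x2) y2) x1
      - ρ2 y2 (ρ2 (ρ1 x1 x2) y1) - ρ2 x2 (ρ2 (ρ1 y1 y2) x1) + ρ2 (br2 x2 y2) (br1 x1 y1)
      + ρ2 (ρ1 (ρ2 x2 y1) y2) x1 + ρ2 (ρ1 (ρ2 y2 x1) x2) y1 = 0)

/-- A matched pair of Malcev algebras. -/
def IsMatchedPairMalcev (br1 : A1 → A1 → A1) (br2 : A2 → A2 → A2)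
    (ρ1 : A1 → Module.End K A2) (ρ2 : A2 → Module.End K A1) : Prop :=
  IsMalcev K br1 ∧ IsMalcev K br2 ∧ IsMalcevRep K br1 ρ1 ∧ IsMalcevRep K br2 ρ2 ∧
  MalcevCompatHalf K br1 br2 ρ1 ρ2 ∧ MalcevCompatHalf K br2 br1 ρ2 ρ1

/-- A matched pair of commutative associative algebras. -/
def IsMatchedPairComm (m1 : A1 → A1 → A1) (m2 : A2 → A2 → A2)
    (μ1 : A1 → Module.End K A2) (μ2 : A2 → Module.End K A1) : Prop :=
  IsCommAssoc K m1 ∧ IsCommAssoc K m2 ∧ IsAssocRep K m1 μ1 ∧ IsAssocRep K m2 μ2 ∧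
  (∀ (x1 : A1) (x2 y2 : A2), μ1 x1 (m2 x2 y2) = m2 (μ1 x1 x2) y2 + μ1 (μ2 x2 x1) y2) ∧
  (∀ (x2 : A2) (x1 y1 : A1), μ2 x2 (m1 x1 y1) = m1 (μ2 x2 x1) y1 + μ2 (μ1 x1 x2) y1)

/-- A matched pair of Malcev-Poisson algebras. -/
def IsMatchedPairMP (br1 m1 : A1 → A1 → A1) (br2 m2 : A2 → A2 → A2)
    (ρ1 μ1 : A1 → Module.End K A2) (ρ2 μ2 : A2 → Module.End K A1) : Prop :=
  IsMatchedPairMalcev K br1 br2 ρ1 ρ2 ∧ IsMatchedPairComm K m1 m2 μ1 μ2 ∧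
  IsMPRep K br1 m1 ρ1 μ1 ∧ IsMPRep K br2 m2 ρ2 μ2 ∧
  (∀ (x2 : A2) (x1 y1 : A1),
      ρ2 x2 (m1 x1 y1) =
        m1 (ρ2 x2 x1) y1 + m1 x1 (ρ2 x2 y1) - μ2 (ρ1 x1 x2) y1 - μ2 (ρ1 y1 x2) x1) ∧
  (∀ (x1 : A1) (x2 y2 : A2),
      ρ1 x1 (m2 x2 y2) =
        m2 (ρ1 x1 x2) y2 + m2 x2 (ρ1 x1 y2) - μ1 (ρ2 x2 x1) y2 - μ1 (ρ2 y2 x1) x2) ∧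
  (∀ (x1 y1 : A1) (x2 : A2),
      br1 x1 (μ2 x2 y1) - ρ2 (μ1 y1 x2) x1 =
        μ2 (ρ1 x1 x2) y1 - m1 (ρ2 x2 x1) y1 + μ2 x2 (br1 x1 y1)) ∧
  (∀ (x2 y2 : A2) (x1 : A1),
      br2 x2 (μ1 x1 y2) - ρ1 (μ2 y2 x1) x2 =
        μ1 (ρ2 x2 x1) y2 - m2 (ρ1 x1 x2) y2 + μ1 x1 (br2 x2 y2))

/-- The bracket on the direct sum of a (candidate) matched pair. -/
def prodBr (br1 : A1 → A1 → A1) (br2 : A2 → A2 → A2)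
    (ρ1 : A1 → Module.End K A2) (ρ2 : A2 → Module.End K A1) :
    A1 × A2 → A1 × A2 → A1 × A2 :=
  fun p q => (br1 p.1 q.1 + ρ2 p.2 q.1 - ρ2 q.2 p.1, br2 p.2 q.2 + ρ1 p.1 q.2 - ρ1 q.1 p.2)

/-- The product on the direct sum of a (candidate) matched pair. -/
def prodMul (m1 : A1 → A1 → A1) (m2 : A2 → A2 → A2)
    (μ1 : A1 → Module.End K A2) (μ2 : A2 → Module.End K A1) :
    A1 × A2 → A1 × A2 → A1 × A2 :=
  fun p q => (m1 p.1 q.1 + μ2 p.2 q.1 + μ2 q.2 p.1, m2 p.2 q.2 + μ1 p.1 q.2 + μ1 q.1 p.2)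

end Matched

section Tensor
variable {A : Type*} [AddCommGroup A] [Module K A]

/-- The binary operation on the dual space induced by a comultiplication:
`⟨x, op(ξ,η)⟩ = ⟨δ(x), ξ⊗η⟩`. -/
noncomputable def dualOp (δ : A →ₗ[K] A ⊗[K] A) :
    Module.Dual K A → Module.Dual K A → Module.Dual K A :=
  fun ξ η => TensorProduct.lift (ξ.smulRight η) ∘ₗ δ

/-- The cyclic permutation `σ(x⊗y⊗z⊗t) = y⊗z⊗t⊗x`. -/
noncomputable def cyc4 : (((A ⊗[K] A) ⊗[K] A) ⊗[K] A) →ₗ[K] (((A ⊗[K] A) ⊗[K] A) ⊗[K] A) :=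
  (TensorProduct.comm K A ((A ⊗[K] A) ⊗[K] A)).toLinearMap ∘ₗ
    (TensorProduct.assoc K A (A ⊗[K] A) A).toLinearMap ∘ₗ
      (TensorProduct.congr (TensorProduct.assoc K A A A) (LinearEquiv.refl K A)).toLinearMap

/-- A Malcev coalgebra. -/
noncomputable def IsMalcevCoalg (δ : A →ₗ[K] A ⊗[K] A) : Prop :=
  ((TensorProduct.comm K A A).toLinearMap ∘ₗ δ = -δ) ∧
  ((TensorProduct.assoc K (A ⊗[K] A) A A).symm.toLinearMap ∘ₗ TensorProduct.map δ δ ∘ₗ δ =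
    (LinearMap.id + cyc4 K + cyc4 K ∘ₗ cyc4 K + cyc4 K ∘ₗ cyc4 K ∘ₗ cyc4 K) ∘ₗ
      TensorProduct.map (TensorProduct.map δ LinearMap.id) LinearMap.id ∘ₗ
        TensorProduct.map δ LinearMap.id ∘ₗ δ)

/-- A cocommutative coassociative coalgebra. -/
def IsCoCommCoassoc (Δ : A →ₗ[K] A ⊗[K] A) : Prop :=
  ((TensorProduct.comm K A A).toLinearMap ∘ₗ Δ = Δ) ∧
  (TensorProduct.map LinearMap.id Δ ∘ₗ Δ =
    (TensorProduct.assoc K A A A).toLinearMap ∘ₗ TensorProduct.map Δ LinearMap.id ∘ₗ Δ)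

/-- A Malcev-Poisson coalgebra. -/
noncomputable def IsMPCoalg (Δ δ : A →ₗ[K] A ⊗[K] A) : Prop :=
  IsCoCommCoassoc K Δ ∧ IsMalcevCoalg K δ ∧
  TensorProduct.map LinearMap.id Δ ∘ₗ δ
    - (TensorProduct.assoc K A A A).toLinearMap ∘ₗ TensorProduct.map δ LinearMap.id ∘ₗ Δ
    - (TensorProduct.leftComm K A A A).toLinearMap ∘ₗ TensorProduct.map LinearMap.id δ ∘ₗ Δ = 0

/-- The bracket as a linear map on the tensor square. -/
noncomputable def brTensor (br : A → A → A) (h : IsBilin K br) : A ⊗[K] A →ₗ[K] A :=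
  TensorProduct.lift (mkBilin K br h)

/-- `(id⊗m⊗id)(id⊗τ⊗id) : (a⊗b)⊗(c⊗d) ↦ a⊗([c,b]⊗d)`. -/
noncomputable def mixA (br : A → A → A) (h : IsBilin K br) :
    (A ⊗[K] A) ⊗[K] (A ⊗[K] A) →ₗ[K] A ⊗[K] (A ⊗[K] A) :=
  TensorProduct.map LinearMap.id (TensorProduct.map (brTensor K br h) LinearMap.id) ∘ₗ
    TensorProduct.map LinearMap.id (TensorProduct.assoc K A A A).symm.toLinearMap ∘ₗ
      TensorProduct.map LinearMap.id (TensorProduct.leftComm K A A A).toLinearMap ∘ₗ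
        (TensorProduct.assoc K A A (A ⊗[K] A)).toLinearMap

/-- `(id⊗id⊗m)(id⊗τ⊗id) : (a⊗b)⊗(c⊗d) ↦ a⊗(c⊗[b,d])`. -/
noncomputable def mixB (br : A → A → A) (h : IsBilin K br) :
    (A ⊗[K] A) ⊗[K] (A ⊗[K] A) →ₗ[K] A ⊗[K] (A ⊗[K] A) :=
  TensorProduct.map LinearMap.id (TensorProduct.map LinearMap.id (brTensor K br h)) ∘ₗ
    TensorProduct.map LinearMap.id (TensorProduct.leftComm K A A A).toLinearMap ∘ₗ
      (TensorProduct.assoc K A A (A ⊗[K] A)).toLinearMap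

/-- Compatibility condition (B1) of a Malcev bialgebra. -/
def MalcevBialgB1 (br : A → A → A) (h : IsBilin K br) (δ : A →ₗ[K] A ⊗[K] A) : Prop :=
  ∀ x y z : A,
    δ (br (br x y) z)
      + TensorProduct.map LinearMap.id (mkEnd K br h x) (δ (br y z))
      + TensorProduct.map (mkEnd K br h y) LinearMap.id (δ (br x z))
    = TensorProduct.map (mkEnd K br h (br z y)) LinearMap.id (δ x)
      + TensorProduct.map (mkEnd K br h z) (mkEnd K br h y) (δ x)
      + TensorProduct.map LinearMap.id (mkEnd K br h z ∘ₗ mkEnd K br h y) (δ x)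
      - TensorProduct.map (mkEnd K br h z ∘ₗ mkEnd K br h x) LinearMap.id (δ y)
      - TensorProduct.map (mkEnd K br h x) (mkEnd K br h z) (δ y)
      + TensorProduct.map LinearMap.id (mkEnd K br h (br x z)) (δ y)
      + TensorProduct.map (mkEnd K br h x ∘ₗ mkEnd K br h y) LinearMap.id (δ z)
      - TensorProduct.map LinearMap.id (mkEnd K br h y ∘ₗ mkEnd K br h x) (δ z)

/-- Compatibility condition (B2) of a Malcev bialgebra. -/
noncomputable def MalcevBialgB2 (br : A → A → A) (h : IsBilin K br) (δ : A →ₗ[K] A ⊗[K] A) :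
    Prop :=
  ∀ x y : A,
    TensorProduct.map LinearMap.id δ (δ (br x y))
    = TensorProduct.map LinearMap.id (TensorProduct.map LinearMap.id (mkEnd K br h x))
        (TensorProduct.map LinearMap.id δ (δ y))
      + (TensorProduct.assoc K A A A).toLinearMap
          (TensorProduct.map δ LinearMap.id (TensorProduct.map (mkEnd K br h x) LinearMap.id (δ y)))
      + mixA K br h (δ y ⊗ₜ[K] δ x)
      - TensorProduct.map (mkEnd K br h y) LinearMap.id
          ((TensorProduct.assoc K A A A).toLinearMap (TensorProduct.map δ LinearMap.id (δ x)))
      - TensorProduct.map LinearMap.id (TensorProduct.map LinearMap.id (mkEnd K br h y))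
          ((TensorProduct.assoc K A A A).toLinearMap (TensorProduct.map δ LinearMap.id (δ x)))
      + mixB K br h (δ x ⊗ₜ[K] δ y)
      - TensorProduct.map LinearMap.id (TensorProduct.comm K A A).toLinearMap
          (TensorProduct.map LinearMap.id (TensorProduct.map LinearMap.id (mkEnd K br h x))
            ((TensorProduct.assoc K A A A).toLinearMap (TensorProduct.map δ LinearMap.id (δ y))))
      + TensorProduct.map LinearMap.id (TensorProduct.comm K A A).toLinearMap
          ((TensorProduct.assoc K A A A).toLinearMap
            (TensorProduct.map δ LinearMap.id (TensorProduct.map (mkEnd K br h y) LinearMap.id (δ x))))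
      - TensorProduct.map LinearMap.id (TensorProduct.map (mkEnd K br h y) LinearMap.id)
          (TensorProduct.map LinearMap.id δ (δ x))
      + TensorProduct.map LinearMap.id (TensorProduct.comm K A A).toLinearMap
          (TensorProduct.map (mkEnd K br h x) LinearMap.id
            ((TensorProduct.assoc K A A A).toLinearMap (TensorProduct.map δ LinearMap.id (δ y))))

end Tensor

section Coadj
variable {A : Type*} [AddCommGroup A] [Module K A] [Module.IsReflexive K A]

/-- The coadjoint-type action of a bracket on the dual space, transported back to `A`
through the canonical isomorphism `A ≃ A**`:
`⟨coadjDouble(ξ)x, η⟩ = −⟨x, [ξ,η]*⟩`. -/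
noncomputable def coadjDouble (brS : Module.Dual K A → Module.Dual K A → Module.Dual K A)
    (h : IsBilin K brS) : Module.Dual K A → Module.End K A :=
  fun ξ => -((Module.evalEquiv K A).symm.toLinearMap ∘ₗ
      (IsLinearMap.mk' (brS ξ) (h.1 ξ)).dualMap ∘ₗ (Module.evalEquiv K A).toLinearMap)

/-- `⟨comulDouble(ξ)x, η⟩ = ⟨x, ξ∘η⟩` : the action `−L*` of the dual product, transported
back to `A` through `A ≃ A**`. -/
noncomputable def comulDouble (mS : Module.Dual K A → Module.Dual K A → Module.Dual K A)
    (h : IsBilin K mS) : Module.Dual K A → Module.End K A :=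
  fun ξ => (Module.evalEquiv K A).symm.toLinearMap ∘ₗ
      (IsLinearMap.mk' (mS ξ) (h.1 ξ)).dualMap ∘ₗ (Module.evalEquiv K A).toLinearMap

end Coadj

section Bilin
variable {F : Type*} [Field F]
variable {A B : Type*} [AddCommGroup A] [Module F A] [AddCommGroup B] [Module F B]

lemma IsBilin.add_left {m : A → A → B} (h : IsBilin F m) (x y z : A) :
    m (x + y) z = m x z + m y z := (h.2 z).map_add x y

lemma IsBilin.add_right {m : A → A → B} (h : IsBilin F m) (x y z : A) :
    m x (y + z) = m x y + m x z := (h.1 x).map_add y z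

lemma IsBilin.neg_left {m : A → A → B} (h : IsBilin F m) (x y : A) : m (-x) y = -m x y :=
  (h.2 y).map_neg x

lemma IsBilin.neg_right {m : A → A → B} (h : IsBilin F m) (x y : A) : m x (-y) = -m x y :=
  (h.1 x).map_neg y

lemma IsBilin.zero_left {m : A → A → B} (h : IsBilin F m) (y : A) : m 0 y = 0 :=
  (h.2 y).map_zero

lemma IsBilin.zero_right {m : A → A → B} (h : IsBilin F m) (x : A) : m x 0 = 0 :=
  (h.1 x).map_zero

end Bilin

section SagleDefect
variable {F : Type*} [Field F] {A : Type*} [AddCommGroup A] [Module F A]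

/-- The difference of the two sides of Sagle's identity. -/
def sagleDefect (br : A → A → A) (x y z t : A) : A :=
  br (br x z) (br y t) -
    (br (br (br x y) z) t + br (br (br y z) t) x + br (br (br z t) x) y + br (br (br t x) y) z)

lemma sagleIdentity_iff_sagleDefect_eq_zero (br : A → A → A) :
    SagleIdentity br ↔ ∀ x y z t, sagleDefect br x y z t = 0 := by
  simp only [SagleIdentity, sagleDefect, sub_eq_zero]

lemma sagleDefect_cycle {br : A → A → A} (h : IsBilin F br) (hs : IsSkew br) (x y z t : A) :
    sagleDefect br y z t x = sagleDefect br x y z t := by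
  have e : br (br y t) (br z x) = br (br x z) (br y t) := by
    rw [hs (br y t), hs z x, h.neg_left, neg_neg]
  simp only [sagleDefect, e]
  abel

lemma sagleDefect_add {br : A → A → A} (h : IsBilin F br) (x x' y z t : A) :
    sagleDefect br (x + x') y z t = sagleDefect br x y z t + sagleDefect br x' y z t := by
  simp only [sagleDefect, h.add_left, h.add_right]
  abel

/-- On a direct sum, the vanishing of the Sagle defect only has to be tested on homogeneous
arguments, up to cyclic permutation. -/
lemma sagleDefect_eq_zero_of_homogeneous {A' : Type*} [AddCommGroup A'] [Module F A']
    {br : A × A' → A × A' → A × A'} (h : IsBilin F br) (hs : IsSkew br)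
    (h1111 : ∀ x y z t : A, sagleDefect br (x, 0) (y, 0) (z, 0) (t, 0) = 0)
    (h1112 : ∀ (x y z : A) (t : A'), sagleDefect br (x, 0) (y, 0) (z, 0) (0, t) = 0)
    (h1122 : ∀ (x y : A) (z t : A'), sagleDefect br (x, 0) (y, 0) (0, z) (0, t) = 0)
    (h1212 : ∀ (x z : A) (y t : A'), sagleDefect br (x, 0) (0, y) (z, 0) (0, t) = 0)
    (h2221 : ∀ (x y z : A') (t : A), sagleDefect br (0, x) (0, y) (0, z) (t, 0) = 0)
    (h2222 : ∀ x y z t : A', sagleDefect br (0, x) (0, y) (0, z) (0, t) = 0)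
    (x y z t : A × A') : sagleDefect br x y z t = 0 := by
  have cyc := sagleDefect_cycle h hs
  have split : ∀ u v w s : A × A', sagleDefect br (u.1, 0) v w s = 0 →
      sagleDefect br (0, u.2) v w s = 0 → sagleDefect br u v w s = 0 := by
    intro u v w s h1 h2
    have := sagleDefect_add h (u.1, 0) (0, u.2) v w s
    simpa [h1, h2] using this
  have r1 : ∀ a b c d, sagleDefect br b c d a = 0 → sagleDefect br a b c d = 0 :=
    fun a b c d e => (cyc a b c d).symm.trans e
  apply split <;> apply r1 <;> apply split <;> apply r1 <;> apply split <;> apply r1 <;>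
    apply split <;> first
    | apply h1111 | apply h1112 | apply h1122 | apply h1212 | apply h2221 | apply h2222
    | (apply r1; first | apply h1112 | apply h1122 | apply h1212 | apply h2221)
    | (apply r1; apply r1; first | apply h1112 | apply h1122 | apply h2221)
    | (apply r1; apply r1; apply r1; first | apply h1112 | apply h1122 | apply h2221)

end SagleDefect

section DirectSum
variable {F : Type*} [Field F]
variable {A1 A2 : Type*} [AddCommGroup A1] [Module F A1] [AddCommGroup A2] [Module F A2]
variable {br1 : A1 → A1 → A1} {br2 : A2 → A2 → A2}
variable {ρ1 : A1 → Module.End F A2} {ρ2 : A2 → Module.End F A1}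

lemma isBilin_prodBr (h1 : IsBilin F br1) (h2 : IsBilin F br2)
    (l1 : IsLinearMap F ρ1) (l2 : IsLinearMap F ρ2) : IsBilin F (prodBr F br1 br2 ρ1 ρ2) := by
  refine ⟨fun x => ⟨fun y z => ?_, fun c y => ?_⟩, fun x => ⟨fun y z => ?_, fun c y => ?_⟩⟩ <;>
    ext <;>
    simp only [prodBr, Prod.fst_add, Prod.snd_add, Prod.smul_fst, Prod.smul_snd, smul_sub,
      smul_add, map_add, map_smul, l1.map_add, l2.map_add, l1.map_smul, l2.map_smul,
      LinearMap.add_apply, LinearMap.smul_apply, h1.add_left, h1.add_right, h2.add_left,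
      h2.add_right, (h1.1 _).map_smul, (h1.2 _).map_smul, (h2.1 _).map_smul,
      (h2.2 _).map_smul] <;> abel

lemma isSkew_prodBr (s1 : IsSkew br1) (s2 : IsSkew br2) :
    IsSkew (prodBr F br1 br2 ρ1 ρ2) := by
  intro x y
  ext
  · simp only [prodBr, Prod.fst_neg, s1 x.1 y.1]; abel
  · simp only [prodBr, Prod.snd_neg, s2 x.2 y.2]; abel

lemma sagleDefect_prodBr_fst_fst_fst_fst (h2 : IsBilin F br2)
    (l2 : IsLinearMap F ρ2) (x y z t : A1) :
    sagleDefect (prodBr F br1 br2 ρ1 ρ2) (x, 0) (y, 0) (z, 0) (t, 0) =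
      (sagleDefect br1 x y z t, 0) := by
  ext <;> simp [sagleDefect, prodBr, h2.zero_left, l2.map_zero]

lemma isMalcevRepMap_iff_sagleDefect (h1 : IsBilin F br1) (h2 : IsBilin F br2)
    (l1 : IsLinearMap F ρ1) (l2 : IsLinearMap F ρ2) :
    IsMalcevRepMap F br1 ρ1 ↔ ∀ (x y z : A1) (t : A2),
      (sagleDefect (prodBr F br1 br2 ρ1 ρ2) (x, 0) (y, 0) (z, 0) (0, t)).2 = 0 := by
  simp only [IsMalcevRepMap, LinearMap.ext_iff]
  refine forall₃_congr fun x y z => forall_congr' fun t => ?_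
  rw [← sub_eq_zero, ← neg_eq_zero]
  apply Eq.congr_left
  simp [sagleDefect, prodBr, h1.zero_left, h2.zero_left, h1.zero_right, h2.zero_right,
    l1.map_zero, l2.map_zero]
  abel

lemma malcevCompatHalf_iff_sagleDefect (h1 : IsBilin F br1) (h2 : IsBilin F br2)
    (l1 : IsLinearMap F ρ1) (l2 : IsLinearMap F ρ2) :
    MalcevCompatHalf F br1 br2 ρ1 ρ2 ↔
      (∀ (x y z : A1) (t : A2),
        (sagleDefect (prodBr F br1 br2 ρ1 ρ2) (x, 0) (y, 0) (z, 0) (0, t)).1 = 0) ∧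
      (∀ (x y : A1) (z t : A2),
        (sagleDefect (prodBr F br1 br2 ρ1 ρ2) (x, 0) (y, 0) (0, z) (0, t)).1 = 0) ∧
      (∀ (x y : A1) (z t : A2),
        (sagleDefect (prodBr F br1 br2 ρ1 ρ2) (x, 0) (0, z) (y, 0) (0, t)).1 = 0) := by
  refine and_congr ?_ (and_congr ?_ ?_)
  · refine forall₄_congr fun x y z t => ?_
    rw [← neg_eq_zero]
    apply Eq.congr_left
    simp [sagleDefect, prodBr, h1.zero_left, h2.zero_left, h1.zero_right, h2.zero_right,
      h1.neg_left, h1.neg_right, h1.add_left, l1.map_zero, l2.map_zero, l1.map_neg, l2.map_neg]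
    abel
  · refine forall₄_congr fun x y z t => ?_
    apply Eq.congr_left
    simp [sagleDefect, prodBr, h1.zero_left, h2.zero_left, h1.zero_right, h2.zero_right,
      h1.neg_left, h1.neg_right, l1.map_zero, l2.map_zero, l1.map_neg, l2.map_neg, l2.map_add]
    abel
  · refine forall₄_congr fun x y z t => ?_
    rw [← neg_eq_zero]
    apply Eq.congr_left
    simp [sagleDefect, prodBr, h1.zero_left, h2.zero_left, h1.zero_right, h2.zero_right,
      h1.neg_left, h2.neg_left, l1.map_zero, l2.map_zero, l1.map_neg, l2.map_neg, l2.map_add]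
    abel

/-- The direct sum bracket is a Malcev bracket exactly when the data form a matched pair. -/
lemma isMalcev_prodBr_iff (h1 : IsMalcev F br1) (h2 : IsMalcev F br2)
    (l1 : IsLinearMap F ρ1) (l2 : IsLinearMap F ρ2) :
    IsMalcev F (prodBr F br1 br2 ρ1 ρ2) ↔ IsMatchedPairMalcev F br1 br2 ρ1 ρ2 := by
  obtain ⟨b1, s1, g1⟩ := h1
  obtain ⟨b2, s2, g2⟩ := h2
  have b := isBilin_prodBr b1 b2 l1 l2
  have s : IsSkew (prodBr F br1 br2 ρ1 ρ2) := isSkew_prodBr s1 s2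
  have cyc := sagleDefect_cycle b s
  have sw : ∀ x y z t : A1 × A2,
      sagleDefect (prodBr F br2 br1 ρ2 ρ1) x.swap y.swap z.swap t.swap =
        (sagleDefect (prodBr F br1 br2 ρ1 ρ2) x y z t).swap := fun _ _ _ _ => rfl
  simp only [IsMatchedPairMalcev, IsMalcevRep, isMalcevRepMap_iff_sagleDefect b1 b2 l1 l2,
    isMalcevRepMap_iff_sagleDefect b2 b1 l2 l1,
    malcevCompatHalf_iff_sagleDefect b1 b2 l1 l2,
    malcevCompatHalf_iff_sagleDefect b2 b1 l2 l1]
  constructor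
  · rintro ⟨-, -, g⟩
    rw [sagleIdentity_iff_sagleDefect_eq_zero] at g
    have g' : ∀ x y z t : A2 × A1, sagleDefect (prodBr F br2 br1 ρ2 ρ1) x y z t = 0 :=
      fun x y z t => (sw x.swap y.swap z.swap t.swap).trans (by rw [g]; rfl)
    simp only [g, g']
    exact ⟨⟨b1, s1, g1⟩, ⟨b2, s2, g2⟩, by simp [l1, l2]⟩
  · rintro ⟨-, -, ⟨-, m1⟩, ⟨-, m2⟩, ⟨c1, c3, c5⟩, c2, c4, c6⟩
    refine ⟨b, s, (sagleIdentity_iff_sagleDefect_eq_zero _).2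
      (sagleDefect_eq_zero_of_homogeneous b s ?_ ?_ ?_ ?_ ?_ ?_)⟩
    · intro x y z t
      rw [sagleDefect_prodBr_fst_fst_fst_fst b2 l2,
        (sagleIdentity_iff_sagleDefect_eq_zero br1).1 g1]
      rfl
    · exact fun x y z t => Prod.ext (c1 x y z t) (m1 x y z t)
    · refine fun x y z t => Prod.ext (c3 x y z t) ?_
      rw [← cyc, ← cyc]
      exact c4 z t x y
    · refine fun x z y t => Prod.ext (c5 x z y t) ?_
      rw [← cyc]
      exact c6 y t z x
    · exact fun x y z t => Prod.ext (m2 x y z t) (c2 x y z t)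
    · intro x y z t
      have := sagleDefect_prodBr_fst_fst_fst_fst (br1 := br2) (ρ1 := ρ2) b1 l1 x y z t
      rw [(sagleIdentity_iff_sagleDefect_eq_zero br2).1 g2] at this
      exact congrArg Prod.swap this

end DirectSum

section Double
variable {F : Type*} [Field F] {A : Type*} [AddCommGroup A] [Module F A]

lemma dualRepNeg_mkEnd_apply {br : A → A → A} (h : IsBilin F br) (x y : A)
    (ξ : Module.Dual F A) : dualRepNeg F (mkEnd F br h) x ξ y = -ξ (br x y) := rfl

lemma isLinearMap_dualRepNeg_mkEnd {br : A → A → A} (h : IsBilin F br) :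
    IsLinearMap F (dualRepNeg F (mkEnd F br h)) := by
  refine ⟨fun x y => ?_, fun c x => ?_⟩ <;> ext ξ z
  · simp only [LinearMap.add_apply, dualRepNeg_mkEnd_apply, h.add_left, map_add, neg_add]
  · simp only [LinearMap.smul_apply, dualRepNeg_mkEnd_apply, (h.2 _).map_smul, map_smul, smul_neg]

variable [Module.IsReflexive F A]

lemma apply_coadjDouble {brS : Module.Dual F A → Module.Dual F A → Module.Dual F A}
    (h : IsBilin F brS) (ξ η : Module.Dual F A) (x : A) :
    η (coadjDouble F brS h ξ x) = -brS ξ η x := by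
  simp [coadjDouble]

lemma eq_of_forall_dual_apply_eq {x y : A} (h : ∀ η : Module.Dual F A, η x = η y) : x = y :=
  (Module.evalEquiv F A).injective (LinearMap.ext h)

lemma isLinearMap_coadjDouble {brS : Module.Dual F A → Module.Dual F A → Module.Dual F A}
    (h : IsBilin F brS) : IsLinearMap F (coadjDouble F brS h) := by
  refine ⟨fun ξ ζ => LinearMap.ext fun x => eq_of_forall_dual_apply_eq (F := F) fun η => ?_,
    fun c ξ => LinearMap.ext fun x => eq_of_forall_dual_apply_eq (F := F) fun η => ?_⟩
  · simp only [LinearMap.add_apply, map_add, apply_coadjDouble, h.add_left, neg_add]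
  · simp only [LinearMap.smul_apply, map_smul, apply_coadjDouble, (h.2 _).map_smul, smul_neg]

/-- An invariant bracket on `A ⊕ A*` is determined by its restrictions to `A` and `A*`. -/
lemma eq_prodBr_of_invariant {br : A → A → A} (h : IsBilin F br)
    {brS : Module.Dual F A → Module.Dual F A → Module.Dual F A} (hS : IsBilin F brS)
    {Br : A × Module.Dual F A → A × Module.Dual F A → A × Module.Dual F A}
    (hB : IsBilin F Br) (sB : IsSkew Br)
    (hA : ∀ x y : A, Br (x, 0) (y, 0) = (br x y, 0))
    (hA' : ∀ ξ η : Module.Dual F A, Br (0, ξ) (0, η) = (0, brS ξ η))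
    (hinv : ∀ u v w : A × Module.Dual F A,
      w.2 (Br u v).1 + (Br u v).2 w.1 = (Br v w).2 u.1 + u.2 (Br v w).1) :
    Br = prodBr F br brS (dualRepNeg F (mkEnd F br h)) (coadjDouble F brS hS) := by
  have mixed : ∀ (x : A) (ξ : Module.Dual F A), Br (x, 0) (0, ξ) =
      (-coadjDouble F brS hS ξ x, dualRepNeg F (mkEnd F br h) x ξ) := by
    intro x ξ
    refine Prod.ext (eq_of_forall_dual_apply_eq (F := F) fun η => ?_) (LinearMap.ext fun y => ?_)
    · simpa [hA', apply_coadjDouble] using hinv (x, 0) (0, ξ) (0, η)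
    · have := hinv (0, ξ) (x, 0) (y, 0)
      rw [sB (0, ξ)] at this
      simpa [hA, dualRepNeg_mkEnd_apply, neg_eq_iff_eq_neg] using this
  funext ⟨x, ξ⟩ ⟨y, η⟩
  have e : ∀ (x : A) (ξ : Module.Dual F A), (x, ξ) = (x, 0) + (0, ξ) := by simp
  rw [e x ξ, e y η, hB.add_left, hB.add_right, hB.add_right, hA, hA', sB (0, ξ), mixed, mixed]
  ext <;> simp [prodBr] <;> abel

lemma prodBr_invariant {br : A → A → A} (h : IsBilin F br) (s : IsSkew br)
    {brS : Module.Dual F A → Module.Dual F A → Module.Dual F A} (hS : IsBilin F brS)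
    (sS : IsSkew brS) {Br : A × Module.Dual F A → A × Module.Dual F A → A × Module.Dual F A}
    (hBr : Br = prodBr F br brS (dualRepNeg F (mkEnd F br h)) (coadjDouble F brS hS))
    (u v w : A × Module.Dual F A) :
    w.2 (Br u v).1 + (Br u v).2 w.1 = (Br v w).2 u.1 + u.2 (Br v w).1 := by
  subst hBr
  simp only [prodBr, map_add, map_sub, LinearMap.add_apply, LinearMap.sub_apply,
    apply_coadjDouble, dualRepNeg_mkEnd_apply]
  rw [sS w.2 u.2, sS u.2 v.2, s u.1 w.1, s u.1 v.1]
  simp only [map_neg, LinearMap.neg_apply]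
  ring

end Double

/-- There is a Malcev algebra structure on `A ⊕ A*` extending the given
structures on `A` and `A*` and making the standard bilinear form
`B_d(x+ξ, y+η) = η(x) + ξ(y)` invariant, iff `(A, A*, ad*_A, ad*_{A*})` is a matched
pair of Malcev algebras. -/
theorem maninTriple_iff_matchedPair_malcev
    {A : Type*} [AddCommGroup A] [Module K A] [FiniteDimensional K A]
    (br : A → A → A) (hbr : IsMalcev K br)
    (brS : Module.Dual K A → Module.Dual K A → Module.Dual K A) (hbrS : IsMalcev K brS) :
    (∃ Br : A × Module.Dual K A → A × Module.Dual K A → A × Module.Dual K A,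
        IsMalcev K Br ∧
        (∀ x y : A, Br (x, 0) (y, 0) = (br x y, 0)) ∧
        (∀ ξ η : Module.Dual K A, Br (0, ξ) (0, η) = (0, brS ξ η)) ∧
        (∀ u v w : A × Module.Dual K A,
          w.2 (Br u v).1 + (Br u v).2 w.1 = (Br v w).2 u.1 + u.2 (Br v w).1)) ↔
      IsMatchedPairMalcev K br brS (dualRepNeg K (mkEnd K br hbr.1))
        (coadjDouble K brS hbrS.1) := by
  have l1 := isLinearMap_dualRepNeg_mkEnd hbr.1
  have l2 := isLinearMap_coadjDouble hbrS.1
  rw [← isMalcev_prodBr_iff hbr hbrS l1 l2]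
  constructor
  · rintro ⟨Br, hBr, hA, hA', hinv⟩
    rwa [← eq_prodBr_of_invariant hbr.1 hbrS.1 hBr.1 hBr.2.1 hA hA' hinv]
  · refine fun hM => ⟨_, hM, fun x y => ?_, fun ξ η => ?_,
      prodBr_invariant hbr.1 hbr.2.1 hbrS.1 hbrS.2.1 rfl⟩
    · simp [prodBr, hbrS.1.zero_left, l2.map_zero]
    · simp [prodBr, hbr.1.zero_left, l1.map_zero]

end MPA
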